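/- Let (Γ,d) be a non-elementary uniformly quasi-geodesic hyperbolic group whose Gromov boundary coincides with its horofunction boundary. Then for every n, t > 0 and every ε > 0 there exists r_0 > 0 with the following property: for every Gromov sequence {x_i} ⊂ Γ, with associated horofunction h(y) := lim_i (d(x_i,y) − d(x_i,e)), and all g, g' ∈ Γ with d(g,e) ≥ r_0, d(g,g') ≤ n and |h(g)| ≤ t, one has | ( d(g,e) − h(g) ) − ( d(g',e) − h(g') ) | ≤ ε. Equivalently, there is a function β = β(r,n,t) ≥ 0 with lim_{r→∞} β(r,n,t) = 0 for all n,t, bounding the left-hand side whenever d(g,e) ≥ r, d(g,g') ≤ n and |h(g)| ≤ t. -/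

import Mathlib

open Filter

/-- The Gromov product `(x|y)_z` for a metric `d`. -/
noncomputable def gromovProd {Γ : Type} (d : Γ → Γ → ℝ) (x y z : Γ) : ℝ :=
  (d x z + d y z - d x y) / 2

section GromovProductLemmas

variable {Γ : Type} {d : Γ → Γ → ℝ}

theorem gromovProd_comm (hsymm : ∀ x y, d x y = d y x) (x y z : Γ) :
    gromovProd d x y z = gromovProd d y x z := by
  unfold gromovProd
  rw [hsymm x y]
  ring

theorem gromovProd_le_dist (hsymm : ∀ x y, d x y = d y x)
    (htri : ∀ x y z, d x z ≤ d x y + d y z) (x y z : Γ) :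
    gromovProd d x y z ≤ d x z := by
  unfold gromovProd
  linarith [htri y x z, hsymm x y]

/-- In a uniformly quasi-geodesic space, a point far from `o` can be approximated, as seen from
`o`, by a point at bounded distance from `o`. -/
theorem exists_gromovProd_ge_of_quasiGeodesic (hself : ∀ x, d x x = 0)
    (hsymm : ∀ x y, d x y = d y x) {c : ℝ} (hc : 0 < c)
    (hqg : ∀ x y : Γ, ∃ (s t : ℝ) (γ : ℝ → Γ), s ≤ t ∧ γ s = x ∧ γ t = y ∧
      ∀ i ∈ Set.Icc s t, ∀ j ∈ Set.Icc s t,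
        |i - j| - c ≤ d (γ i) (γ j) ∧ d (γ i) (γ j) ≤ |i - j| + c)
    (o : Γ) {m : ℝ} (hm : 0 ≤ m) (u : Γ) :
    ∃ p : Γ, d o p ≤ m + c ∧ (m ≤ d u o → m - 5 * c / 2 ≤ gromovProd d u p o) := by
  by_cases hu : m ≤ d u o
  · obtain ⟨s, t, γ, hst, rfl, rfl, hγ⟩ := hqg o u
    have hs : s ∈ Set.Icc s t := ⟨le_rfl, hst⟩
    have ht : t ∈ Set.Icc s t := ⟨hst, le_rfl⟩
    have hi : min (s + m) t ∈ Set.Icc s t :=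
      ⟨le_min (by linarith) hst, min_le_right _ _⟩
    obtain ⟨h₁, h₂⟩ := hγ _ hi s hs
    obtain ⟨-, h₃⟩ := hγ t ht _ hi
    obtain ⟨h₄, h₅⟩ := hγ t ht s hs
    rw [abs_of_nonneg (sub_nonneg.2 hi.1)] at h₁ h₂
    rw [abs_of_nonneg (sub_nonneg.2 hi.2)] at h₃
    rw [abs_of_nonneg (sub_nonneg.2 hst)] at h₄ h₅
    have hle : min (s + m) t ≤ s + m := min_le_left _ _
    have hge : s + m - c ≤ min (s + m) t := le_min (by linarith) (by linarith)
    refine ⟨γ (min (s + m) t), ?_, fun _ => ?_⟩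
    · rw [hsymm]
      linarith
    · unfold gromovProd
      linarith
  · exact ⟨o, by rw [hself]; linarith, fun h => absurd h hu⟩

/-- In a proper uniformly quasi-geodesic hyperbolic space, every sequence tending to infinity has
a subsequence which is a Gromov sequence. -/
theorem exists_gromovSequence_subseq (hself : ∀ x, d x x = 0)
    (hsymm : ∀ x y, d x y = d y x) (o : Γ) (hproper : ∀ R : ℝ, {g : Γ | d o g ≤ R}.Finite)
    {δ : ℝ} (hhyp : ∀ x y z w : Γ,
      gromovProd d x y w ≥ min (gromovProd d x z w) (gromovProd d y z w) - δ)
    {c : ℝ} (hc : 0 < c)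
    (hqg : ∀ x y : Γ, ∃ (s t : ℝ) (γ : ℝ → Γ), s ≤ t ∧ γ s = x ∧ γ t = y ∧
      ∀ i ∈ Set.Icc s t, ∀ j ∈ Set.Icc s t,
        |i - j| - c ≤ d (γ i) (γ j) ∧ d (γ i) (γ j) ≤ |i - j| + c)
    (u : ℕ → Γ) (hu : Tendsto (fun k => d (u k) o) atTop atTop) :
    ∃ φ : ℕ → ℕ, StrictMono φ ∧
      Tendsto (fun ij : ℕ × ℕ => gromovProd d (u (φ ij.1)) (u (φ ij.2)) o) atTop atTop := by
  choose P hP₁ hP₂ using fun (m : ℕ) (v : Γ) =>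
    exists_gromovProd_ge_of_quasiGeodesic hself hsymm hc hqg o (Nat.cast_nonneg m) v
  let _ : TopologicalSpace Γ := ⊥
  have : DiscreteTopology Γ := ⟨rfl⟩
  have hK : IsCompact (Set.pi Set.univ fun m : ℕ => {g : Γ | d o g ≤ m + c}) :=
    isCompact_univ_pi fun m => (hproper _).isCompact
  obtain ⟨q, -, φ, hφ, hq⟩ :=
    hK.tendsto_subseq (x := fun k m => P m (u k)) fun k m _ => hP₁ m (u k)
  refine ⟨φ, hφ, tendsto_atTop.2 fun b => ?_⟩
  obtain ⟨m, hm⟩ := exists_nat_ge (b + 5 * c / 2 + δ)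
  have hev : ∀ᶠ k in atTop, b + δ ≤ gromovProd d (u (φ k)) (q m) o := by
    have h₁ := tendsto_pi_nhds.1 hq m
    rw [nhds_discrete, tendsto_pure] at h₁
    filter_upwards [h₁, (hu.comp hφ.tendsto_atTop).eventually_ge_atTop (m : ℝ)] with k hk hk'
    have h₂ := hP₂ m (u (φ k)) hk'
    simp only [Function.comp_apply] at hk
    rw [hk] at h₂
    linarith
  rw [← prod_atTop_atTop_eq]
  filter_upwards [hev.prod_mk hev] with ij hij
  have := hhyp (u (φ ij.1)) (u (φ ij.2)) (q m) o
  linarith [le_min hij.1 hij.2]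

/-- A sequence whose Gromov products with a Gromov sequence tend to infinity is itself a Gromov
sequence. -/
theorem tendsto_gromovProd_of_equivalent (hsymm : ∀ x y, d x y = d y x) {o : Γ}
    {δ : ℝ} (hhyp : ∀ x y z w : Γ,
      gromovProd d x y w ≥ min (gromovProd d x z w) (gromovProd d y z w) - δ)
    {u v : ℕ → Γ}
    (hu : Tendsto (fun ij : ℕ × ℕ => gromovProd d (u ij.1) (u ij.2) o) atTop atTop)
    (huv : Tendsto (fun k => gromovProd d (u k) (v k) o) atTop atTop) :
    Tendsto (fun ij : ℕ × ℕ => gromovProd d (v ij.1) (v ij.2) o) atTop atTop := by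
  refine tendsto_atTop.2 fun b => ?_
  have h₁ := huv.eventually_ge_atTop (max (b + δ) (b + 2 * δ))
  have h₂ := hu.eventually_ge_atTop (b + 2 * δ)
  rw [← prod_atTop_atTop_eq] at h₂ ⊢
  filter_upwards [h₁.prod_mk h₁, h₂] with ij hij hij'
  have h₃ := hhyp (v ij.1) (v ij.2) (u ij.1) o
  have h₄ := hhyp (v ij.2) (u ij.1) (u ij.2) o
  rw [gromovProd_comm hsymm (v ij.1) (u ij.1)] at h₃
  rw [gromovProd_comm hsymm (v ij.2) (u ij.2)] at h₄
  have h₅ := le_min ((le_max_right _ _).trans hij.2) hij'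
  have h₆ : b + δ ≤ gromovProd d (v ij.2) (u ij.1) o := by linarith
  linarith [le_min ((le_max_left _ _).trans hij.1) h₆]

/-- If the Gromov boundary coincides with the horofunction boundary, then the normalized distance
functions of two points are close at `a` as soon as the points have large Gromov product. -/
theorem exists_abs_sub_le_of_gromovProd_ge (hself : ∀ x, d x x = 0)
    (hsymm : ∀ x y, d x y = d y x) (htri : ∀ x y z, d x z ≤ d x y + d y z)
    (o : Γ) (hproper : ∀ R : ℝ, {g : Γ | d o g ≤ R}.Finite)
    {δ : ℝ} (hhyp : ∀ x y z w : Γ,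
      gromovProd d x y w ≥ min (gromovProd d x z w) (gromovProd d y z w) - δ)
    {c : ℝ} (hc : 0 < c)
    (hqg : ∀ x y : Γ, ∃ (s t : ℝ) (γ : ℝ → Γ), s ≤ t ∧ γ s = x ∧ γ t = y ∧
      ∀ i ∈ Set.Icc s t, ∀ j ∈ Set.Icc s t,
        |i - j| - c ≤ d (γ i) (γ j) ∧ d (γ i) (γ j) ≤ |i - j| + c)
    (hexist : ∀ x : ℕ → Γ,
      Tendsto (fun ij : ℕ × ℕ => gromovProd d (x ij.1) (x ij.2) o) atTop atTop →
      ∀ y : Γ, ∃ L : ℝ, Tendsto (fun i => d (x i) y - d (x i) o) atTop (nhds L))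
    (hunique : ∀ x x' : ℕ → Γ,
      Tendsto (fun ij : ℕ × ℕ => gromovProd d (x ij.1) (x ij.2) o) atTop atTop →
      Tendsto (fun ij : ℕ × ℕ => gromovProd d (x' ij.1) (x' ij.2) o) atTop atTop →
      Tendsto (fun i => gromovProd d (x i) (x' i) o) atTop atTop →
      ∀ (y : Γ) (L L' : ℝ),
        Tendsto (fun i => d (x i) y - d (x i) o) atTop (nhds L) →
        Tendsto (fun i => d (x' i) y - d (x' i) o) atTop (nhds L') → L = L')
    (a : Γ) {ε : ℝ} (hε : 0 < ε) :
    ∃ R : ℝ, ∀ u v : Γ, R ≤ gromovProd d u v o →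
      |(d u a - d u o) - (d v a - d v o)| ≤ ε := by
  by_contra! hcon
  choose u v huv hlt using fun k : ℕ => hcon k
  have huv' : Tendsto (fun k => gromovProd d (u k) (v k) o) atTop atTop :=
    tendsto_atTop_mono huv tendsto_natCast_atTop_atTop
  obtain ⟨φ, hφ, hu⟩ := exists_gromovSequence_subseq hself hsymm o hproper hhyp hc hqg u
    (tendsto_atTop_mono (fun k => gromovProd_le_dist hsymm htri _ _ _) huv')
  have huvφ := huv'.comp hφ.tendsto_atTop
  have hv := tendsto_gromovProd_of_equivalent (u := u ∘ φ) (v := v ∘ φ) hsymm hhyp hu huvφ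
  obtain ⟨L, hL⟩ := hexist (u ∘ φ) hu a
  obtain ⟨L', hL'⟩ := hexist (v ∘ φ) hv a
  obtain rfl := hunique _ _ hu hv huvφ a L L' hL hL'
  have hlim := (hL.sub hL').abs
  rw [sub_self, abs_zero] at hlim
  obtain ⟨k, hk⟩ := (hlim.eventually_lt_const hε).exists
  exact lt_asymm hk (hlt (φ k))

end GromovProductLemmas

theorem stmt_16
    {Γ : Type} [Group Γ] [Countable Γ] (d : Γ → Γ → ℝ)
    (hzero : ∀ x y : Γ, d x y = 0 ↔ x = y)
    (hsymm : ∀ x y : Γ, d x y = d y x)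
    (htri : ∀ x y z : Γ, d x z ≤ d x y + d y z)
    (hinv : ∀ g x y : Γ, d (g * x) (g * y) = d x y)
    (hproper : ∀ R : ℝ, {g : Γ | d 1 g ≤ R}.Finite)
    (hhyp : ∃ δ : ℝ, 0 ≤ δ ∧ ∀ x y z w : Γ,
      gromovProd d x y w ≥ min (gromovProd d x z w) (gromovProd d y z w) - δ)
    (hqg : ∃ c : ℝ, 0 < c ∧ ∀ x y : Γ, ∃ (s t : ℝ) (γ : ℝ → Γ), s ≤ t ∧ γ s = x ∧ γ t = y ∧
      ∀ i ∈ Set.Icc s t, ∀ j ∈ Set.Icc s t,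
        |i - j| - c ≤ d (γ i) (γ j) ∧ d (γ i) (γ j) ≤ |i - j| + c)
    (hinfinite : Infinite Γ)
    (hnonelem : ¬ ∃ H : Subgroup Γ, H.FiniteIndex ∧ IsCyclic H)
    -- the Gromov boundary coincides with the horofunction boundary:
    (hexist : ∀ x : ℕ → Γ,
      Tendsto (fun ij : ℕ × ℕ => gromovProd d (x ij.1) (x ij.2) 1) atTop atTop →
      ∀ y : Γ, ∃ L : ℝ, Tendsto (fun i => d (x i) y - d (x i) 1) atTop (nhds L))
    (hunique : ∀ x x' : ℕ → Γ,
      Tendsto (fun ij : ℕ × ℕ => gromovProd d (x ij.1) (x ij.2) 1) atTop atTop →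
      Tendsto (fun ij : ℕ × ℕ => gromovProd d (x' ij.1) (x' ij.2) 1) atTop atTop →
      Tendsto (fun i => gromovProd d (x i) (x' i) 1) atTop atTop →
      ∀ (y : Γ) (L L' : ℝ),
        Tendsto (fun i => d (x i) y - d (x i) 1) atTop (nhds L) →
        Tendsto (fun i => d (x' i) y - d (x' i) 1) atTop (nhds L') → L = L') :
    ∀ n t ε : ℝ, 0 < n → 0 < t → 0 < ε → ∃ r₀ : ℝ, 0 < r₀ ∧
      ∀ x : ℕ → Γ,
        Tendsto (fun ij : ℕ × ℕ => gromovProd d (x ij.1) (x ij.2) 1) atTop atTop →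
        ∀ h : Γ → ℝ,
          (∀ y : Γ, Tendsto (fun i => d (x i) y - d (x i) 1) atTop (nhds (h y))) →
          ∀ g g' : Γ, r₀ ≤ d g 1 → d g g' ≤ n → |h g| ≤ t →
            |(d g 1 - h g) - (d g' 1 - h g')| ≤ ε := by
  intro n t ε hn ht hε
  obtain ⟨δ, -, hδ⟩ := hhyp
  obtain ⟨c, hc, hqg⟩ := hqg
  choose R hR using fun a : Γ => exists_abs_sub_le_of_gromovProd_ge
    (fun x => (hzero x x).2 rfl) hsymm htri 1 hproper hδ hc hqg hexist hunique a hε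
  obtain ⟨M, hM⟩ := ((hproper n).image R).bddAbove
  refine ⟨max 1 (2 * M + t + 1), lt_max_of_lt_left one_pos, ?_⟩
  intro x _ h hh g g' hg hgg' hht
  have hd : ∀ y z : Γ, d (g⁻¹ * y) z = d y (g * z) := fun y z => by
    rw [← hinv g, mul_inv_cancel_left]
  have hd₁ : ∀ z : Γ, d g⁻¹ z = d 1 (g * z) := fun z => by simpa using hd 1 z
  have ha : R (g⁻¹ * g') ≤ M := hM (Set.mem_image_of_mem R (by
    change d 1 (g⁻¹ * g') ≤ n
    rw [hsymm, hd, mul_one, hsymm]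
    exact hgg'))
  have hlarge : -t - 1 < h g := by linarith [(abs_le.1 hht).1]
  have hclose : ∀ᶠ i in atTop,
      |(d g' 1 - d g 1) - ((d (x i) g' - d (x i) 1) - (d (x i) g - d (x i) 1))| ≤ ε := by
    filter_upwards [(hh g).eventually_const_lt hlarge] with i hi
    have key := hR (g⁻¹ * g') g⁻¹ (g⁻¹ * x i) (by
      simp only [gromovProd, hd, hd₁, mul_one, mul_inv_cancel_left]
      linarith [le_max_right 1 (2 * M + t + 1), hsymm g 1, hsymm 1 (x i)])
    simp only [hd, hd₁, mul_one, mul_inv_cancel_left] at key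
    rw [hsymm g' 1, hsymm g 1]
    convert key using 2
    ring
  have hlim := le_of_tendsto ((((hh g').sub (hh g)).const_sub (d g' 1 - d g 1)).abs) hclose
  rw [← abs_neg] at hlim
  exact (congrArg abs (by ring)).trans_le hlim
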